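/- There does not exist a nontrivial regular partial difference set with parameters (v,k,λ,μ) = (9150625, 3495030, 1334465, 1335180) in any abelian group G of order 9150625 = 5⁴·11⁴. -/

import Mathlib

/-- `D` is a `(v,k,λ,μ)` partial difference set in the group `G` (written
multiplicatively): `|G| = v`, `|D| = k`, every non-identity element of `D` is represented
exactly `lam` times as `g * h⁻¹` with `g, h ∈ D`, `g ≠ h`, and every non-identity element
of `G` not in `D` exactly `mu` times. -/
def IsPDS {G : Type*} [Group G] (D : Set G) (v k lam mu : ℕ) : Prop :=
  Nat.card G = v ∧ D.ncard = k ∧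
  (∀ z : G, z ≠ 1 → z ∈ D →
    {p : G × G | p.1 ∈ D ∧ p.2 ∈ D ∧ p.1 ≠ p.2 ∧ p.1 * p.2⁻¹ = z}.ncard = lam) ∧
  (∀ z : G, z ≠ 1 → z ∉ D →
    {p : G × G | p.1 ∈ D ∧ p.2 ∈ D ∧ p.1 ≠ p.2 ∧ p.1 * p.2⁻¹ = z}.ncard = mu)

/-- `D` is regular: it avoids the identity and is closed under inversion. -/
def IsRegularPDS {G : Type*} [Group G] (D : Set G) : Prop :=
  (1 : G) ∉ D ∧ ∀ g ∈ D, g⁻¹ ∈ D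

/-- `D` is a trivial PDS: `D ∪ {1}` or `G \ D` is a subgroup of `G`. -/
def IsTrivialPDS {G : Type*} [Group G] (D : Set G) : Prop :=
  (∃ H : Subgroup G, D ∪ {1} = (H : Set G)) ∨ ∃ H : Subgroup G, Dᶜ = (H : Set G)

theorem pds_coeff_smul {K : Type*} [CommGroup K] (n : ℤ) (x : MonoidAlgebra ℤ K) (y : K) :
    (n • x).coeff y = n * x.coeff y := by
  rw [MonoidAlgebra.coeff_smul_apply, smul_eq_mul]

open MonoidAlgebra in
theorem pds_frob {K : Type*} [CommGroup K] [Fintype K] (p : ℕ) [Fact p.Prime]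
    (hinj : Function.Injective (fun y : K => y ^ p)) (x : MonoidAlgebra ℤ K) (y : K) :
    (((x ^ p).coeff (y ^ p) : ℤ) : ZMod p) = ((x.coeff y : ℤ) : ZMod p) := by
  classical
  have : CharP (MonoidAlgebra (ZMod p) K) p :=
    charP_of_injective_algebraMap (FaithfulSMul.algebraMap_injective (ZMod p) _) p
  set φ := MonoidAlgebra.mapRingHom K (Int.castRingHom (ZMod p)) with hφ
  have hc : ∀ (z : MonoidAlgebra ℤ K) (y : K), ((z.coeff y : ℤ) : ZMod p) = (φ z).coeff y := by
    intro z y; simp [hφ]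
  rw [hc, hc, map_pow φ x p]
  generalize φ x = w
  have hw : w = ∑ z : K, single z (w.coeff z) := by
    ext a; simp
  conv_lhs => rw [hw, sum_pow_char]
  simp only [single_pow, ZMod.pow_card, coeff_sum, coeff_single]
  rw [Finsupp.finsetSum_apply, Finset.sum_eq_single y]
  · simp
  · intro b _ hb
    rw [Finsupp.single_apply, if_neg (fun h => hb (hinj h))]
  · simp

theorem pds_dvd {K : Type*} [CommGroup K] [Fintype K]
    (hinj : Function.Injective (fun y : K => y ^ 5)) (x c : MonoidAlgebra ℤ K)
    (h : x * x = (5 : ℤ) • c) : ∃ b : MonoidAlgebra ℤ K, x = (5 : ℤ) • b := by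
  have : Fact (Nat.Prime 5) := ⟨by norm_num⟩
  have key : ∀ y, (5 : ℤ) ∣ x.coeff y := by
    intro y
    have := pds_frob 5 hinj x y
    have h5 : x ^ 5 = (5 : ℤ) • (c * x ^ 3) := by
      rw [← smul_mul_assoc, ← h]; ring
    rw [h5] at this
    rw [← Nat.cast_ofNat, ← ZMod.intCast_zmod_eq_zero_iff_dvd, ← this]
    rw [pds_coeff_smul, Int.cast_mul, (ZMod.intCast_zmod_eq_zero_iff_dvd 5 5).2 (by norm_num), zero_mul]
  choose f hf using key
  refine ⟨∑ y : K, MonoidAlgebra.single y (f y), ?_⟩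
  classical
  ext y
  rw [pds_coeff_smul, hf]; simp [Finsupp.single_apply]

theorem pds_dvd25 {K : Type*} [CommGroup K] [Fintype K]
    (hinj : Function.Injective (fun y : K => y ^ 5)) (x : MonoidAlgebra ℤ K) (m : ℤ)
    (h : x * x = (25 * m) • x) (y : K) : 25 ∣ x.coeff y := by
  obtain ⟨b, hb⟩ := pds_dvd hinj x ((5 * m) • x) (by rw [h, smul_smul]; ring_nf)
  have h2 : b * b = (5 : ℤ) • (m • b) := by
    have : (25 : ℤ) • (b * b) = (25 : ℤ) • ((5 : ℤ) • (m • b)) := by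
      have := h
      rw [hb, smul_mul_smul_comm] at this
      simp only [smul_smul] at this ⊢
      rw [show (25 : ℤ) * (5 * m) = 25 * m * 5 by ring]; exact this
    ext y
    have := congrArg (fun z : MonoidAlgebra ℤ K => z.coeff y) this
    simp only [pds_coeff_smul] at this ⊢
    linarith
  obtain ⟨b', hb'⟩ := pds_dvd hinj b _ h2
  refine ⟨b'.coeff y, ?_⟩
  rw [hb, hb', pds_coeff_smul, pds_coeff_smul]; ring

theorem pds_four {G : Type*} [CommGroup G] [DecidableEq G] (S : Finset G)
    (h625 : ∀ x ∈ S, x ^ 625 = 1) (h1 : (1 : G) ∉ S) (hinv : ∀ x ∈ S, x⁻¹ ∈ S)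
    (h2 : ∀ x ∈ S, x ^ 2 ∈ S) : 4 ∣ S.card := by
  have hpow : ∀ n : ℕ, ∀ x ∈ S, x ^ (2 ^ n) ∈ S := by
    intro n
    induction n with
    | zero => intro x hx; simpa using hx
    | succ n ih => intro x hx; rw [pow_succ, pow_mul]; exact h2 _ (ih x hx)
  have ht : ∀ x ∈ S, x ^ 182 ∈ S := by
    intro x hx
    have e : x ^ 182 = x ^ (2 ^ 125) := by
      have hd : orderOf x ∣ 625 := orderOf_dvd_of_pow_eq_one (h625 x hx)
      have : 182 ≡ 2 ^ 125 [MOD 625] := by decide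
      exact pow_eq_pow_iff_modEq.2 (this.of_dvd hd)
    rw [e]; exact hpow _ x hx
  have hsq : ∀ x ∈ S, (x ^ 182) ^ 182 = x⁻¹ := by
    intro x hx
    rw [eq_inv_iff_mul_eq_one, ← pow_mul, ← pow_succ,
      show 182 * 182 + 1 = 625 * 53 by norm_num, pow_mul, h625 x hx, one_pow]
  have hne : ∀ x ∈ S, x ≠ x⁻¹ := by
    intro x hx h
    have h' : x ^ 2 = 1 := by rw [pow_two]; nth_rewrite 2 [h]; simp
    have := h625 x hx
    rw [show 625 = 2 * 312 + 1 by norm_num, pow_succ, pow_mul, h', one_pow, one_mul] at this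
    exact h1 (this ▸ hx)
  let q : G → Finset G := fun x => {x, x ^ 182, x⁻¹, (x ^ 182)⁻¹}
  have q1 : ∀ x ∈ S, q (x ^ 182) = q x := by
    intro x hx
    simp only [q, hsq x hx, inv_inv]
    ext z; simp; tauto
  have q2 : ∀ x, q x⁻¹ = q x := by
    intro x
    simp only [q, inv_inv, inv_pow]
    ext z; simp; tauto
  rw [Finset.card_eq_sum_card_image q S]
  apply Finset.dvd_sum
  intro b hb
  obtain ⟨x, hx, rfl⟩ := Finset.mem_image.1 hb
  have : S.filter (fun a => q a = q x) = q x := by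
    ext z
    simp only [Finset.mem_filter]
    constructor
    · rintro ⟨_, h⟩
      rw [← h]; simp [q]
    · intro hz
      simp only [q, Finset.mem_insert, Finset.mem_singleton] at hz
      rcases hz with rfl | rfl | rfl | rfl
      · exact ⟨hx, rfl⟩
      · exact ⟨ht x hx, q1 x hx⟩
      · exact ⟨hinv x hx, q2 x⟩
      · exact ⟨hinv _ (ht x hx), by rw [q2, q1 x hx]⟩
  rw [this]
  have n1 : x ≠ x ^ 182 := by
    intro h
    have := hsq x hx
    rw [← h, ← h] at this
    exact hne x hx this
  have n2 : x ≠ (x ^ 182)⁻¹ := by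
    intro h
    have h' : x ^ 182 = x⁻¹ := by rw [h, inv_inv, ← h]
    have := hsq x hx
    rw [h', inv_pow, h', inv_inv] at this
    exact hne x hx this
  have n3 : x ^ 182 ≠ x⁻¹ := by
    intro h; apply n2; rw [h, inv_inv]
  have n4 : x⁻¹ ≠ (x ^ 182)⁻¹ := by
    intro h; exact n1 (inv_injective h)
  have : (q x).card = 4 := by
    simp only [q]
    rw [Finset.card_insert_of_notMem, Finset.card_insert_of_notMem, Finset.card_insert_of_notMem,
      Finset.card_singleton]
    · simpa using n1
    · simp only [Finset.mem_insert, Finset.mem_singleton, not_or]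
      exact ⟨n3, hne _ (ht x hx)⟩
    · simp only [Finset.mem_insert, Finset.mem_singleton, not_or]
      exact ⟨n1, hne x hx, n2⟩
  rw [this]

open MonoidAlgebra in
theorem pds_mul_T {K : Type*} [CommGroup K] [Fintype K] (x : MonoidAlgebra ℤ K) :
    x * (∑ y : K, single y (1 : ℤ)) = (∑ y, x.coeff y) • (∑ y : K, single y (1 : ℤ)) := by
  classical
  have hx : x = ∑ z : K, single z (x.coeff z) := by
    ext a; simp [Finsupp.single_apply]
  conv_lhs => rw [hx]
  rw [Finset.sum_mul, Finset.sum_smul]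
  refine Finset.sum_congr rfl fun z _ => ?_
  rw [Finset.mul_sum, Finset.smul_sum]
  simp only [single_mul_single, mul_one]
  rw [← Equiv.sum_comp (Equiv.mulLeft z) (fun y : K => x.coeff z • single y (1 : ℤ))]
  refine Finset.sum_congr rfl fun y _ => ?_
  ext a
  rw [pds_coeff_smul]
  simp [Finsupp.single_apply]

theorem pds_coeff_T {K : Type*} [CommGroup K] [Fintype K] (y : K) :
    (∑ y : K, MonoidAlgebra.single y (1 : ℤ)).coeff y = 1 := by
  classical
  simp [Finsupp.single_apply]

open MonoidAlgebra in
theorem pds_core {K : Type*} [CommGroup K] [Fintype K] (hK : Fintype.card K = 14641)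
    (d : MonoidAlgebra ℤ K) (hsum : ∑ y, d.coeff y = 3495030)
    (hsymm : ∀ y, d.coeff y⁻¹ = d.coeff y) (h0 : 0 ≤ d.coeff 1)
    (hd : d * d = (834487500 : ℤ) • (∑ y : K, single y (1 : ℤ)) + (-715 : ℤ) • d
      + (2159850 : ℤ) • (1 : MonoidAlgebra ℤ K)) :
    d.coeff 1 = 5 ∨ d.coeff 1 = 30 := by
  classical
  have hinj : Function.Injective (fun y : K => y ^ 5) := by
    have : (Nat.card K).Coprime 5 := by rw [Nat.card_eq_fintype_card, hK]; norm_num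
    exact (powCoprime this).injective
  set T : MonoidAlgebra ℤ K := ∑ y : K, single y (1 : ℤ) with hT
  have hdT : d * T = (3495030 : ℤ) • T := by rw [hT, pds_mul_T, hsum]
  have hTT : T * T = (14641 : ℤ) • T := by
    conv_lhs => rw [hT, pds_mul_T]
    simp only [pds_coeff_T]
    simp [hK, ← hT]
  have hsq : ((14641 : ℤ) • (d + (1870 : ℤ) • 1) - (3496900 : ℤ) • T) *
      ((14641 : ℤ) • (d + (1870 : ℤ) • 1) - (3496900 : ℤ) • T) =
      (25 * (121 * 14641) : ℤ) • ((14641 : ℤ) • (d + (1870 : ℤ) • 1) - (3496900 : ℤ) • T) := by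
    simp only [zsmul_eq_mul] at *
    push_cast at *
    linear_combination (14641 ^ 2) * hd - (2 * 14641 * 3496900) * hdT + (3496900 ^ 2) * hTT
  have h25 := pds_dvd25 hinj _ _ hsq
  have hco : ∀ y, ((14641 : ℤ) • (d + (1870 : ℤ) • 1) - (3496900 : ℤ) • T).coeff y
      = 14641 * (d.coeff y + 1870 * (1 : MonoidAlgebra ℤ K).coeff y) - 3496900 := by
    intro y
    rw [coeff_sub, Finsupp.sub_apply, pds_coeff_smul, coeff_add, Finsupp.add_apply,
      pds_coeff_smul, pds_coeff_smul, hT, pds_coeff_T, mul_one]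
  have h1 : (25 : ℤ) ∣ d.coeff 1 - 5 := by
    have := h25 1
    rw [hco, coeff_one_one] at this
    omega
  have hy : ∀ y ≠ 1, (25 : ℤ) ∣ d.coeff y := by
    intro y hy
    have := h25 y
    rw [hco, one_def, coeff_single, Finsupp.single_apply, if_neg (Ne.symm hy)] at this
    omega
  have hsqsum : ∑ y, d.coeff y * d.coeff y = 834487500 - 715 * d.coeff 1 + 2159850 := by
    have e1 : (d * d).coeff 1 = ∑ y, d.coeff y * d.coeff y := by
      rw [coeff_mul_apply_left, Finsupp.sum_fintype]
      · refine Finset.sum_congr rfl fun y _ => ?_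
        rw [mul_one, hsymm]
      · simp
    rw [← e1, hd, coeff_add, coeff_add, Finsupp.add_apply, Finsupp.add_apply, pds_coeff_smul,
      pds_coeff_smul, pds_coeff_smul, hT, pds_coeff_T, coeff_one_one]
    ring
  have hpos : 0 ≤ ∑ y ∈ Finset.univ.erase (1 : K), (d.coeff y - 225) * (d.coeff y - 250) := by
    refine Finset.sum_nonneg fun y hy' => ?_
    obtain ⟨m, hm⟩ := hy y (Finset.ne_of_mem_erase hy')
    rw [hm]
    rcases le_or_gt m 9 with h | h
    · nlinarith
    · have : 10 ≤ m := h
      nlinarith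
  have hall : ∑ y : K, (d.coeff y - 225) * (d.coeff y - 250)
      = (834487500 - 715 * d.coeff 1 + 2159850) - 475 * 3495030 + 14641 * 56250 := by
    have : ∀ y : K, (d.coeff y - 225) * (d.coeff y - 250)
      = d.coeff y * d.coeff y - 475 * d.coeff y + 56250 := fun y => by ring
    simp only [this]
    rw [Finset.sum_add_distrib, Finset.sum_sub_distrib, ← Finset.mul_sum, hsqsum, hsum]
    simp [hK]
  rw [← Finset.add_sum_erase _ _ (Finset.mem_univ (1 : K))] at hall
  have : d.coeff 1 ≤ 30 := by nlinarith
  omega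

theorem pds_cnt {G : Type*} [CommGroup G] [Fintype G] [DecidableEq G] (D : Set G) (F : Finset G)
    (hF : ∀ x, x ∈ F ↔ x ∈ D) (hinv : ∀ g ∈ D, g⁻¹ ∈ D) (z : G) (hz : z ≠ 1) :
    ((F ×ˢ F).filter (fun p => p.1 * p.2 = z)).card =
    {p : G × G | p.1 ∈ D ∧ p.2 ∈ D ∧ p.1 ≠ p.2 ∧ p.1 * p.2⁻¹ = z}.ncard := by
  have hi : Function.Injective (fun p : G × G => (p.1, p.2⁻¹)) := by
    rintro ⟨a, b⟩ ⟨c, e⟩ h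
    simpa using h
  rw [← Finset.card_image_of_injective _ hi, ← Set.ncard_coe_finset]
  congr 1
  ext ⟨a, b⟩
  simp only [Finset.coe_image, Finset.coe_filter, Finset.mem_product, hF, Set.mem_image,
    Set.mem_setOf_eq, Prod.mk.injEq, Prod.exists]
  constructor
  · rintro ⟨a', b', ⟨⟨ha, hb⟩, h⟩, rfl, rfl⟩
    refine ⟨ha, hinv _ hb, ?_, by simpa using h⟩
    rintro rfl
    exact hz (by rw [← h]; simp)
  · rintro ⟨ha, hb, _, h⟩
    exact ⟨a, b⁻¹, ⟨⟨ha, hinv _ hb⟩, h⟩, rfl, by simp⟩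

open MonoidAlgebra in
theorem no_nontrivial_pds_case20
    (G : Type*) [CommGroup G] (D : Set G)
    (hpds : IsPDS D 9150625 3495030 1334465 1335180)
    (hreg : IsRegularPDS D) :
    IsTrivialPDS D := by
  classical
  exfalso
  obtain ⟨hG, hk, hlam, hmu⟩ := hpds
  obtain ⟨h1, hinv⟩ := hreg
  have : Finite G := Nat.finite_of_card_ne_zero (by rw [hG]; norm_num)
  have : Fintype G := Fintype.ofFinite G
  obtain ⟨F, hF⟩ : ∃ F : Finset G, ∀ x, x ∈ F ↔ x ∈ D :=
    ⟨Finset.univ.filter (· ∈ D), by simp⟩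
  have hFc : F.card = 3495030 := by
    rw [← hk, ← Set.ncard_coe_finset]; congr 1; ext x; simp [hF]
  set d : MonoidAlgebra ℤ G := ∑ a ∈ F, single a (1 : ℤ) with hdd
  have hdc : ∀ g, d.coeff g = if g ∈ D then 1 else 0 := by
    intro g
    rw [hdd, coeff_sum, Finsupp.finsetSum_apply]
    simp [Finsupp.single_apply, hF]
  have hmul : ∀ g, (d * d).coeff g = (((F ×ˢ F).filter (fun p => p.1 * p.2 = g)).card : ℤ) := by
    intro g
    rw [hdd, Finset.sum_mul_sum, ← Finset.sum_product', coeff_sum, Finsupp.finsetSum_apply,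
      Finset.card_filter]
    simp [Finsupp.single_apply, single_mul_single]
  have hcnt1 : ((F ×ˢ F).filter (fun p => p.1 * p.2 = (1 : G))).card = 3495030 := by
    rw [← hFc]
    symm
    refine Finset.card_bij (fun a _ => (a, a⁻¹)) ?_ ?_ ?_
    · intro a ha
      simp [hF] at ha ⊢
      exact ⟨ha, hinv a ha⟩
    · intro a _ b _ h
      exact (Prod.mk.inj h).1
    · rintro ⟨a, b⟩ h
      simp only [Finset.mem_filter, Finset.mem_product] at h
      exact ⟨a, h.1.1, by rw [eq_inv_of_mul_eq_one_right h.2]⟩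
  have hd : d * d = (1335180 : ℤ) • (∑ g : G, single g (1 : ℤ)) + (-715 : ℤ) • d
      + (2159850 : ℤ) • (1 : MonoidAlgebra ℤ G) := by
    ext g
    rw [hmul, coeff_add, coeff_add, Finsupp.add_apply, Finsupp.add_apply, pds_coeff_smul,
      pds_coeff_smul, pds_coeff_smul, pds_coeff_T, hdc, one_def, coeff_single,
      Finsupp.single_apply]
    by_cases hg : g = 1
    · subst hg
      rw [hcnt1, if_neg h1]; norm_num
    · rw [pds_cnt D F hF hinv g hg, if_neg (Ne.symm hg)]
      by_cases hgD : g ∈ D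
      · rw [hlam g hg hgD, if_pos hgD]; norm_num
      · rw [hmu g hg hgD, if_neg hgD]; norm_num
  -- squaring is a multiplier
  have hsqD : ∀ y ∈ D, y ^ 2 ∈ D := by
    intro y hy
    have hinj2 : Function.Injective (fun y : G => y ^ 2) := by
      have : (Nat.card G).Coprime 2 := by rw [hG]; norm_num
      exact (powCoprime this).injective
    have hy2 : y ^ 2 ≠ 1 := by
      intro h
      have : y = 1 := hinj2 (by simpa using h)
      exact h1 (this ▸ hy)
    by_contra hn
    have := pds_frob 2 hinj2 d y
    rw [pow_two d, hmul, pds_cnt D F hF hinv _ hy2, hmu _ hy2 hn, hdc, if_pos hy] at this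
    revert this
    rw [ZMod.intCast_eq_intCast_iff]
    decide
  -- the Sylow 5-subgroup
  have : Fact (Nat.Prime 5) := ⟨by norm_num⟩
  obtain ⟨H, hH⟩ := Sylow.exists_subgroup_card_pow_prime (G := G) 5 (n := 4)
    (by rw [hG]; norm_num)
  have hK : Fintype.card (G ⧸ H) = 14641 := by
    have := Subgroup.card_eq_card_quotient_mul_card_subgroup H
    rw [hG, hH] at this
    rw [← Nat.card_eq_fintype_card]
    omega
  set φ := mapDomainRingHom ℤ (QuotientGroup.mk' H) with hφ
  have hφs : ∀ g : G, φ (single g 1) = single (g : G ⧸ H) 1 := by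
    intro g; simp [hφ]
  have hφd : ∀ y : G ⧸ H, (φ d).coeff y = ((F.filter (fun a : G => (a : G ⧸ H) = y)).card : ℤ) := by
    intro y
    rw [hdd, map_sum, coeff_sum, Finsupp.finsetSum_apply, Finset.card_filter]
    simp only [hφs]
    simp [Finsupp.single_apply]
  have hfib : ∀ y : G ⧸ H, (Finset.univ.filter (fun a : G => (a : G ⧸ H) = y)).card = 625 := by
    intro y
    obtain ⟨b, rfl⟩ := QuotientGroup.mk_surjective y
    have : (5 : ℕ) ^ 4 = 625 := by norm_num
    rw [← this, ← hH, ← Set.ncard_coe_finset, ← Nat.card_coe_set_eq]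
    refine Nat.card_congr ((Equiv.subtypeEquivRight ?_).trans (Subgroup.leftCosetEquivSubgroup b))
    intro a
    simp only [Finset.coe_filter, Finset.mem_univ, true_and, Set.mem_setOf_eq]
    rw [eq_comm, QuotientGroup.eq, mem_leftCoset_iff]; rfl
  have hφT : φ (∑ g : G, single g (1 : ℤ)) = (625 : ℤ) • ∑ y : G ⧸ H, single y (1 : ℤ) := by
    ext y
    rw [pds_coeff_smul, pds_coeff_T, map_sum, coeff_sum, Finsupp.finsetSum_apply]
    simp only [hφs]
    have := hfib y
    rw [Finset.card_filter] at this
    simp only [coeff_single, Finsupp.single_apply]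
    exact_mod_cast this
  have hcore := pds_core hK (φ d) ?_ ?_ ?_ ?_
  · have h4 := pds_four (F.filter (fun a : G => (a : G ⧸ H) = 1)) ?_ ?_ ?_ ?_
    · rw [hφd] at hcore
      omega
    · intro x hx
      have hx := (QuotientGroup.eq_one_iff x).1 (Finset.mem_filter.1 hx).2
      have := pow_card_eq_one' (x := (⟨x, hx⟩ : H))
      rw [hH] at this
      simpa using congrArg Subtype.val this
    · intro h
      exact h1 ((hF 1).1 (Finset.mem_filter.1 h).1)
    · intro x hx
      simp only [Finset.mem_filter, hF] at hx ⊢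
      exact ⟨hinv x hx.1, by rw [QuotientGroup.mk_inv, hx.2, inv_one]⟩
    · intro x hx
      simp only [Finset.mem_filter, hF] at hx ⊢
      exact ⟨hsqD x hx.1, by rw [QuotientGroup.mk_pow, hx.2, one_pow]⟩
  · simp only [hφd]
    rw [← Nat.cast_sum, ← Finset.card_eq_sum_card_fiberwise (fun _ _ => Finset.mem_coe.2 (Finset.mem_univ _)), hFc]
    norm_num
  · intro y
    rw [hφd, hφd]
    congr 1
    refine Finset.card_bij (fun a _ => a⁻¹) ?_ ?_ ?_
    · intro a ha
      simp only [Finset.mem_filter, hF] at ha ⊢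
      exact ⟨hinv a ha.1, by rw [QuotientGroup.mk_inv, ha.2, inv_inv]⟩
    · intro a _ b _ h
      exact inv_injective h
    · intro a ha
      simp only [Finset.mem_filter, hF] at ha
      refine ⟨a⁻¹, ?_, inv_inv a⟩
      simp only [Finset.mem_filter, hF]
      exact ⟨hinv a ha.1, by rw [QuotientGroup.mk_inv, ha.2]⟩
  · rw [hφd]; positivity
  · rw [← map_mul, hd, map_add, map_add, map_zsmul, map_zsmul, map_zsmul, map_one, hφT, smul_smul]
    norm_num
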